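/- arXiv:1301.4643 — 2 statements merged into one kernel-verified Lean document; each statement's English description precedes it below -/
import Mathlib

section
/- If X, Y ∈ F_q^{m×n} are matrices with rk(X) = rk(Y) = r, then (1/2)·d_S(Rowspace(X), Rowspace(Y)) + (1/2)·d_S(Colspace(X), Colspace(Y)) ≤ rk(X − Y) ≤ min{(1/2)·d_S(Rowspace(X), Rowspace(Y)), (1/2)·d_S(Colspace(X), Colspace(Y))} + r. -/
open Matrix

/-- The subspace distance `d_S(U,V) = dim(U+V) - dim(U ∩ V)`. -/
noncomputable def subspaceDist {F : Type*} [Field F] {M : Type*} [AddCommGroup M] [Module F M]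
    (U V : Submodule F M) : ℕ :=
  Module.finrank F ↥(U ⊔ V) - Module.finrank F ↥(U ⊓ V)

/-- The row space of a matrix: the span of its rows. -/
noncomputable def rowSpace {F : Type*} [Field F] {m : ℕ} {ι : Type*}
    (X : Matrix (Fin m) ι F) : Submodule F (ι → F) :=
  Submodule.span F (Set.range fun i => X i)

/-- The column space of a matrix: the span of its columns. -/
noncomputable def colSpace {F : Type*} [Field F] {m n : ℕ}
    (X : Matrix (Fin m) (Fin n) F) : Submodule F (Fin m → F) :=
  rowSpace Xᵀ

section LinearMap

variable {F V W : Type*} [Field F] [AddCommGroup V] [Module F V] [AddCommGroup W] [Module F W]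

theorem finrank_map_add_finrank_ker_inf [FiniteDimensional F V] (f : V →ₗ[F] W)
    (p : Submodule F V) :
    Module.finrank F (p.map f) + Module.finrank F ↥(LinearMap.ker f ⊓ p) = Module.finrank F p := by
  have h := (f.domRestrict p).finrank_range_add_finrank_ker
  rw [LinearMap.range_domRestrict, LinearMap.ker_domRestrict] at h
  rw [← h, inf_comm, ← Submodule.map_comap_subtype]
  congr 1
  exact Submodule.finrank_map_subtype_eq p _

/-- The part of the range common to `f - g` and `f` contains the image under `f` of `ker g`. -/
theorem finrank_range_sup_add_finrank_ker_le [FiniteDimensional F V] [FiniteDimensional F W]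
    (f g : V →ₗ[F] W) :
    Module.finrank F ↥(LinearMap.range f ⊔ LinearMap.range g)
        + Module.finrank F (LinearMap.ker g) ≤
      Module.finrank F (LinearMap.range (f - g)) + Module.finrank F (LinearMap.range f)
        + Module.finrank F ↥(LinearMap.ker f ⊓ LinearMap.ker g) := by
  have hsup : LinearMap.range f ⊔ LinearMap.range g ≤
      LinearMap.range (f - g) ⊔ LinearMap.range f := by
    refine sup_le le_sup_right ?_
    rintro _ ⟨x, rfl⟩
    rw [show g x = -(f - g) x + f x by simp]
    exact Submodule.add_mem_sup (neg_mem (LinearMap.mem_range_self _ x))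
      (LinearMap.mem_range_self _ x)
  have hinf : (LinearMap.ker g).map f ≤ LinearMap.range (f - g) ⊓ LinearMap.range f := by
    rintro _ ⟨x, hx, rfl⟩
    exact ⟨⟨x, by simp [LinearMap.mem_ker.mp hx]⟩, LinearMap.mem_range_self _ x⟩
  have h₁ := Submodule.finrank_mono hsup
  have h₂ := Submodule.finrank_mono hinf
  have h₃ := finrank_map_add_finrank_ker_inf f (LinearMap.ker g)
  have h₄ := Submodule.finrank_sup_add_finrank_inf_eq (LinearMap.range (f - g)) (LinearMap.range f)
  omega

theorem subspaceDist_add_finrank_add_finrank [FiniteDimensional F V] (U U' : Submodule F V) :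
    subspaceDist U U' + (Module.finrank F U + Module.finrank F U') =
      2 * Module.finrank F ↥(U ⊔ U') := by
  have h₁ := Submodule.finrank_sup_add_finrank_inf_eq U U'
  have h₂ := Submodule.finrank_mono (inf_le_sup : U ⊓ U' ≤ U ⊔ U')
  unfold subspaceDist
  omega

end LinearMap

section Matrix

variable {F : Type*} [Field F] {m n : ℕ}

theorem finrank_rowSpace (X : Matrix (Fin m) (Fin n) F) :
    Module.finrank F (rowSpace X) = X.rank :=
  X.rank_eq_finrank_span_row.symm

theorem finrank_colSpace (X : Matrix (Fin m) (Fin n) F) :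
    Module.finrank F (colSpace X) = X.rank := by
  rw [colSpace, finrank_rowSpace, rank_transpose]

theorem colSpace_eq_range (X : Matrix (Fin m) (Fin n) F) :
    colSpace X = LinearMap.range X.mulVecLin :=
  X.range_mulVecLin.symm

theorem rowSpace_sub_le (X Y : Matrix (Fin m) (Fin n) F) :
    rowSpace (X - Y) ≤ rowSpace X ⊔ rowSpace Y := by
  refine Submodule.span_le.mpr ?_
  rintro _ ⟨i, rfl⟩
  exact sub_mem (Submodule.mem_sup_left (Submodule.subset_span ⟨i, rfl⟩))
    (Submodule.mem_sup_right (Submodule.subset_span ⟨i, rfl⟩))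

theorem rank_sub_le_finrank_rowSpace_sup (X Y : Matrix (Fin m) (Fin n) F) :
    (X - Y).rank ≤ Module.finrank F ↥(rowSpace X ⊔ rowSpace Y) := by
  rw [← finrank_rowSpace]
  exact Submodule.finrank_mono (rowSpace_sub_le X Y)

theorem rank_sub_le_finrank_colSpace_sup (X Y : Matrix (Fin m) (Fin n) F) :
    (X - Y).rank ≤ Module.finrank F ↥(colSpace X ⊔ colSpace Y) := by
  rw [← rank_transpose, transpose_sub]
  exact rank_sub_le_finrank_rowSpace_sup Xᵀ Yᵀ

theorem finrank_rowSpace_sup_add_finrank_ker_inf (X Y : Matrix (Fin m) (Fin n) F) :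
    Module.finrank F ↥(rowSpace X ⊔ rowSpace Y)
      + Module.finrank F ↥(LinearMap.ker X.mulVecLin ⊓ LinearMap.ker Y.mulVecLin) = n := by
  have hrow : rowSpace X ⊔ rowSpace Y = Submodule.span F (Set.range (fromRows X Y).row) := by
    rw [rowSpace, rowSpace, ← Submodule.span_union, ← Set.Sum.elim_range]
    congr 2
  have hker : LinearMap.ker X.mulVecLin ⊓ LinearMap.ker Y.mulVecLin =
      LinearMap.ker (fromRows X Y).mulVecLin := by
    ext v
    simp [fromRows_mulVec, funext_iff]
  rw [hrow, hker, ← rank_eq_finrank_span_row, rank, LinearMap.finrank_range_add_finrank_ker,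
    Module.finrank_fin_fun]

theorem finrank_rowSpace_sup_add_finrank_colSpace_sup_le (X Y : Matrix (Fin m) (Fin n) F) :
    Module.finrank F ↥(rowSpace X ⊔ rowSpace Y) + Module.finrank F ↥(colSpace X ⊔ colSpace Y) ≤
      (X - Y).rank + X.rank + Y.rank := by
  have h₁ := finrank_range_sup_add_finrank_ker_le X.mulVecLin Y.mulVecLin
  have h₂ := finrank_rowSpace_sup_add_finrank_ker_inf X Y
  have h₃ := Y.mulVecLin.finrank_range_add_finrank_ker
  have hsub : (X - Y).mulVecLin = X.mulVecLin - Y.mulVecLin := by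
    ext1 v
    simp
  rw [Module.finrank_fin_fun] at h₃
  rw [colSpace_eq_range, colSpace_eq_range, rank, rank, rank, hsub]
  omega

end Matrix

/-- Connection between subspace distance and rank distance: for `X, Y` of equal rank `r`,
`½ d_S(Row X, Row Y) + ½ d_S(Col X, Col Y) ≤ rk(X - Y)
  ≤ min{½ d_S(Row X, Row Y), ½ d_S(Col X, Col Y)} + r`. -/
theorem rank_dist_subspace_dist {F : Type*} [Field F] [Fintype F] {m n r : ℕ}
    (X Y : Matrix (Fin m) (Fin n) F) (hX : X.rank = r) (hY : Y.rank = r) :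
    (subspaceDist (rowSpace X) (rowSpace Y) : ℚ) / 2
        + (subspaceDist (colSpace X) (colSpace Y) : ℚ) / 2 ≤ ((X - Y).rank : ℚ) ∧
    ((X - Y).rank : ℚ) ≤
      min ((subspaceDist (rowSpace X) (rowSpace Y) : ℚ) / 2)
          ((subspaceDist (colSpace X) (colSpace Y) : ℚ) / 2) + r := by
  have h₁ := subspaceDist_add_finrank_add_finrank (rowSpace X) (rowSpace Y)
  have h₂ := subspaceDist_add_finrank_add_finrank (colSpace X) (colSpace Y)
  have h₃ := finrank_rowSpace_sup_add_finrank_colSpace_sup_le X Y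
  have h₄ := rank_sub_le_finrank_rowSpace_sup X Y
  have h₅ := rank_sub_le_finrank_colSpace_sup X Y
  rw [finrank_rowSpace, finrank_rowSpace, hX, hY] at h₁
  rw [finrank_colSpace, finrank_colSpace, hX, hY] at h₂
  rw [hX, hY] at h₃
  qify at h₁ h₂ h₃ h₄ h₅
  rw [← min_add_add_right]
  refine ⟨by linarith, le_min (by linarith) (by linarith)⟩
end

section
/- Existence of a large constant-rank code: Let ⌊(d−1)/2⌋ + 1 ≤ τ < d ≤ n ≤ m and τ ≤ n − τ. Then there exists a set of m×n matrices over F_q, all of rank exactly τ, with pairwise rank distance at least d, of cardinality q^{(n−τ)(τ−⌊(d−1)/2⌋)}. -/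
/-- The `q`-linearized polynomial `∑ aⱼ X ^ (q ^ j)` as an endomorphism of `K`, depending linearly
on its coefficients. -/
noncomputable def linearizedEnd (F K : Type*) [Field F] [Fintype F] [Field K] [Algebra F K]
    (k : ℕ) : (Fin k → K) →ₗ[F] K →ₗ[F] K :=
  ∑ j : Fin k, (LinearMap.lcomp F K ((FiniteField.frobeniusAlgHom F K ^ (j : ℕ)).toLinearMap)) ∘ₗ
    (LinearMap.mul F K) ∘ₗ (LinearMap.proj j)

section

variable {F K : Type*} [Field F] [Fintype F] [Field K] [Algebra F K] {k : ℕ}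

lemma linearizedEnd_apply (a : Fin k → K) (x : K) :
    linearizedEnd F K k a x = ∑ j, a j * x ^ Fintype.card F ^ (j : ℕ) := by
  simp [linearizedEnd, FiniteField.coe_frobeniusAlgHom, pow_iterate]

open Polynomial in
lemma finrank_ker_linearizedEnd_lt [FiniteDimensional F K] {a : Fin k → K} (ha : a ≠ 0) :
    Module.finrank F (LinearMap.ker (linearizedEnd F K k a)) < k := by
  classical
  have : Finite K := Module.finite_of_finite F
  have : Fintype K := .ofFinite K
  have hq : 1 < Fintype.card F := Fintype.one_lt_card
  let p : K[X] := ∑ j, C (a j) * X ^ Fintype.card F ^ (j : ℕ)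
  obtain ⟨i, hi⟩ := Function.ne_iff.mp ha
  have hp : p ≠ 0 := fun h => hi <| by
    have := congrArg (coeff · (Fintype.card F ^ (i : ℕ))) h
    simpa [p, finsetSum_coeff, coeff_X_pow, Nat.pow_right_inj hq, Fin.val_inj] using this
  have hdeg : p.natDegree < Fintype.card F ^ k := by
    rw [natDegree_lt_iff_degree_lt hp, ← mem_degreeLT]
    refine Submodule.sum_mem _ fun j _ => mem_degreeLT.mpr ?_
    exact (degree_C_mul_X_pow_le _ _).trans_lt <| by
      exact_mod_cast Nat.pow_lt_pow_right hq j.isLt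
  have hroots : Nat.card (LinearMap.ker (linearizedEnd F K k a)) ≤ p.natDegree := by
    rw [← SetLike.coe_sort_coe, Nat.card_coe_set_eq, Set.ncard_eq_toFinset_card']
    refine card_le_degree_of_subset_roots fun x hx => ?_
    have hx : linearizedEnd F K k a x = 0 := by simpa using hx
    rw [linearizedEnd_apply] at hx
    simpa [hp, p, eval_finsetSum] using hx
  rw [Module.natCard_eq_pow_finrank (K := F), Nat.card_eq_fintype_card] at hroots
  exact (Nat.pow_lt_pow_iff_right hq).mp (hroots.trans_lt hdeg)

end

/-- Existence of linear maximum rank distance codes. -/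
lemma exists_linear_mrd_code (F : Type*) [Field F] [Fintype F] {N t k : ℕ}
    (ht : 0 < t) (htN : t ≤ N) (hkt : k ≤ t) :
    ∃ W : Submodule F (Matrix (Fin N) (Fin t) F), Module.finrank F W = N * k ∧
      ∀ M ∈ W, M ≠ 0 → t < M.rank + k := by
  have : NeZero N := ⟨by omega⟩
  obtain ⟨p, _⟩ := CharP.exists F
  have : Fact p.Prime := ⟨CharP.char_is_prime F p⟩
  let K := FiniteField.Extension F p N
  have hK : Module.finrank F K = N := FiniteField.finrank_extension F p N
  let e : K ≃ₗ[F] (Fin N → F) := LinearEquiv.ofFinrankEq _ _ (by simp [hK])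
  obtain ⟨g, hg⟩ : ∃ g : (Fin t → F) →ₗ[F] K, Function.Injective g :=
    finrank_le_iff_exists_linearMap.mp (by simpa [hK] using htN)
  let Φ : (Fin k → K) →ₗ[F] Matrix (Fin N) (Fin t) F :=
    LinearMap.toMatrix'.toLinearMap ∘ₗ LinearMap.lcomp F _ g ∘ₗ
      LinearMap.compRight F e.toLinearMap ∘ₗ linearizedEnd F K k
  have hΦ : ∀ a, Φ a = LinearMap.toMatrix' (e.toLinearMap ∘ₗ linearizedEnd F K k a ∘ₗ g) :=
    fun a => rfl
  have hrank : ∀ a, a ≠ 0 → t < (Φ a).rank + k := fun a ha => by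
    have h1 := finrank_ker_linearizedEnd_lt (F := F) ha
    have h2 := (e.toLinearMap ∘ₗ linearizedEnd F K k a ∘ₗ g).finrank_range_add_finrank_ker
    have h3 : Module.finrank F (LinearMap.ker (e.toLinearMap ∘ₗ linearizedEnd F K k a ∘ₗ g)) ≤
        Module.finrank F (LinearMap.ker (linearizedEnd F K k a)) := by
      rw [LinearEquiv.ker_comp, LinearMap.ker_comp, 
        (Submodule.equivMapOfInjective g hg _).finrank_eq]
      exact Submodule.finrank_mono (Submodule.map_comap_le _ _)
    rw [hΦ, Matrix.rank, ← Matrix.toLin'_apply', Matrix.toLin'_toMatrix']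
    simp only [Module.finrank_fin_fun] at h2
    omega
  have hinj : Function.Injective Φ := by
    rw [← LinearMap.ker_eq_bot, LinearMap.ker_eq_bot']
    intro a ha
    by_contra h
    have := hrank a h
    rw [ha, Matrix.rank_zero] at this
    omega
  refine ⟨LinearMap.range Φ, ?_, ?_⟩
  · rw [LinearMap.finrank_range_of_inj hinj, Module.finrank_pi_fintype]
    simp [hK, mul_comm]
  · rintro _ ⟨a, rfl⟩ hne
    exact hrank a fun h => hne (by rw [h, map_zero])

namespace Matrix

lemma rank_add_rank_le_rank_fromBlocks_zero₁₁ {F α β γ δ : Type*} [Field F] [Fintype α]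
    [Fintype β] [Fintype γ] [Fintype δ] (B : Matrix α δ F) (C : Matrix β γ F) (D : Matrix β δ F) :
    B.rank + C.rank ≤ (fromBlocks 0 B C D).rank := by
  let S := LinearMap.range (fromBlocks 0 B C D).mulVecLin
  let π : (α ⊕ β → F) →ₗ[F] (α → F) := LinearMap.funLeft F F Sum.inl
  let ρ : (α ⊕ β → F) →ₗ[F] (β → F) := LinearMap.funLeft F F Sum.inr
  have hB : B.rank ≤ Module.finrank F (LinearMap.range (π.domRestrict S)) := by
    refine Submodule.finrank_mono ?_
    rintro _ ⟨y, rfl⟩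
    refine ⟨⟨_, ⟨Sum.elim 0 y, rfl⟩⟩, ?_⟩
    ext i
    simp [π, LinearMap.funLeft, fromBlocks_mulVec]
  have hC : C.rank ≤ Module.finrank F (LinearMap.ker (π.domRestrict S)) := by
    let f := ρ ∘ₗ S.subtype ∘ₗ (LinearMap.ker (π.domRestrict S)).subtype
    refine (Submodule.finrank_mono (?_ : _ ≤ LinearMap.range f)).trans f.finrank_range_le
    rintro _ ⟨x, rfl⟩
    refine ⟨⟨⟨_, ⟨Sum.elim x 0, rfl⟩⟩, ?_⟩, ?_⟩
    · ext i
      simp [π, LinearMap.funLeft, fromBlocks_mulVec]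
    · ext i
      simp [f, ρ, LinearMap.funLeft, fromBlocks_mulVec]
  have := (π.domRestrict S).finrank_range_add_finrank_ker
  change _ ≤ Module.finrank F S
  omega

/-- The matrix whose column space is spanned by the columns of `L` lifted by an identity block, and
whose row space is spanned by the rows of `R` lifted by an identity block. -/
def liftedProduct {F α β γ : Type*} [Field F] [Fintype α] [DecidableEq α] (L : Matrix β α F)
    (R : Matrix α γ F) : Matrix (α ⊕ β) (α ⊕ γ) F :=
  fromRows 1 L * fromCols 1 R

lemma liftedProduct_eq {F α β γ : Type*} [Field F] [Fintype α] [DecidableEq α] (L : Matrix β α F)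
    (R : Matrix α γ F) : liftedProduct L R = fromBlocks 1 R L (L * R) := by
  simp [liftedProduct]

lemma rank_liftedProduct {F α β γ : Type*} [Field F] [Fintype α] [DecidableEq α] [Fintype γ]
    (L : Matrix β α F) (R : Matrix α γ F) : (liftedProduct L R).rank = Fintype.card α := by
  refine le_antisymm ((rank_mul_le_left _ _).trans (rank_le_card_width _)) ?_
  calc Fintype.card α = ((liftedProduct L R).submatrix Sum.inl Sum.inl).rank := by
        rw [liftedProduct_eq]
        exact (rank_one (R := F)).symm.trans (congrArg rank (toBlocks_fromBlocks₁₁ _ _ _ _).symm)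
    _ ≤ _ := rank_submatrix_le _ _ _

lemma rank_sub_add_rank_sub_le_rank_liftedProduct_sub {F α β γ : Type*} [Field F] [Fintype α]
    [DecidableEq α] [Fintype β] [Fintype γ] (L L' : Matrix β α F) (R R' : Matrix α γ F) :
    (R - R').rank + (L - L').rank ≤ (liftedProduct L R - liftedProduct L' R').rank := by
  have h : liftedProduct L R - liftedProduct L' R' =
      fromBlocks 0 (R - R') (L - L') (L * R - L' * R') := by
    rw [liftedProduct_eq, liftedProduct_eq]
    ext (i | i) (j | j) <;> simp
  rw [h]
  exact rank_add_rank_le_rank_fromBlocks_zero₁₁ _ _ _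

end Matrix

/-- Existence of a large constant-rank code: for
`⌊(d-1)/2⌋ + 1 ≤ τ < d ≤ n ≤ m` and `τ ≤ n - τ`, there exists a set of `m × n` matrices
over `F_q`, all of rank exactly `τ`, with pairwise rank distance at least `d`, of
cardinality `q^{(n-τ)(τ - ⌊(d-1)/2⌋)}`. -/
theorem exists_constant_rank_code {F : Type*} [Field F] [Fintype F] {m n d τ : ℕ}
    (hτlo : (d - 1) / 2 + 1 ≤ τ) (hτd : τ < d) (hdn : d ≤ n) (hnm : n ≤ m)
    (hτn : τ ≤ n - τ) :
    ∃ C : Finset (Matrix (Fin m) (Fin n) F),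
      C.card = (Fintype.card F) ^ ((n - τ) * (τ - (d - 1) / 2)) ∧
      (∀ A ∈ C, A.rank = τ) ∧
      (∀ A ∈ C, ∀ B ∈ C, A ≠ B → d ≤ ((A - B) : Matrix (Fin m) (Fin n) F).rank) := by
  classical
  obtain ⟨W, hW, hWrank⟩ := exists_linear_mrd_code F (N := n - τ) (t := τ)
    (k := τ - (d - 1) / 2) (by omega) hτn (by omega)
  let em : Fin m ≃ Fin τ ⊕ (Fin (n - τ) ⊕ Fin (m - n)) :=
    Fintype.equivOfCardEq (by simp; omega)
  let en : Fin n ≃ Fin τ ⊕ Fin (n - τ) := Fintype.equivOfCardEq (by simp; omega)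
  let f : W → Matrix (Fin m) (Fin n) F := fun M =>
    (Matrix.liftedProduct (Matrix.fromRows M.1 0) M.1.transpose).submatrix em en
  have hdist : ∀ M M' : W, M ≠ M' → d ≤ (f M - f M').rank := fun M M' hne => by
    have h1 := hWrank _ (W.sub_mem M.2 M'.2) (sub_ne_zero.mpr (Subtype.coe_injective.ne hne))
    let L : W → Matrix (Fin (n - τ) ⊕ Fin (m - n)) (Fin τ) F := fun M => Matrix.fromRows M.1 0
    have h2 : (M.1 - M'.1).rank ≤ (L M - L M').rank :=
      Matrix.rank_submatrix_le (L M - L M') Sum.inl id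
    have h3 := Matrix.rank_sub_add_rank_sub_le_rank_liftedProduct_sub (L M) (L M')
      M.1.transpose M'.1.transpose
    rw [← Matrix.transpose_sub, Matrix.rank_transpose] at h3
    have h4 : (f M - f M').rank = _ := Matrix.rank_submatrix
      (Matrix.liftedProduct (L M) M.1.transpose - Matrix.liftedProduct (L M') M'.1.transpose) em en
    omega
  have hinj : Function.Injective f := fun M M' h => by
    by_contra hne
    have := hdist M M' hne
    rw [h, sub_self, Matrix.rank_zero] at this
    omega
  have : Fintype W := .ofFinite W
  refine ⟨Finset.univ.image f, ?_, ?_, ?_⟩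
  · rw [Finset.card_image_of_injective _ hinj, Finset.card_univ,
      Module.card_eq_pow_finrank (K := F), hW]
  · simp [f, Matrix.rank_submatrix, Matrix.rank_liftedProduct]
  · simp only [Finset.mem_image, Finset.mem_univ, true_and]
    rintro _ ⟨M, rfl⟩ _ ⟨M', rfl⟩ hne
    exact hdist M M' fun h => hne (by rw [h])
end
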